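/- Let n ≥ 1, α, β > 0, and let H : ℝⁿ → ℝ be continuous and coercive with H(p) = −α|p| for |p| ≤ β, H(p) = f(p) for |p| ≥ β, where f : ℝⁿ → ℝ is continuous and coercive with f(p) = −αβ whenever |p| = β and min_{ℝⁿ} f = −αβ. Then for every k > 0 the function u_k(x) = αβ e^{(|x| − k)/α}, defined for x in the closure of B(0,k), is the unique state-constraint viscosity solution of u(x) + H(Du(x)) = 0 on B(0,k) (a viscosity subsolution in B(0,k) and a viscosity supersolution on the closure of B(0,k)). -/

import Mathlib

open Metric Set MeasureTheory Filter
open scoped Topology NNReal RealInnerProductSpace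

noncomputable section

abbrev Euc (n : ℕ) := EuclideanSpace ℝ (Fin n)

/-- `v` is a viscosity subsolution of `v + H(x, Dv) = 0` in the open set `Ω`. -/
def IsViscositySubsolutionIn {n : ℕ} (Ω : Set (Euc n)) (H : Euc n → Euc n → ℝ)
    (v : Euc n → ℝ) : Prop :=
  ∀ x ∈ Ω, ∀ φ : Euc n → ℝ, ContDiff ℝ 1 φ →
    IsLocalMaxOn (fun y => v y - φ y) Ω x → v x + H x (gradient φ x) ≤ 0

/-- `v` is a viscosity supersolution of `v + H(x, Dv) = 0` on the closure of `Ω`. -/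
def IsViscositySupersolutionOn {n : ℕ} (Ω : Set (Euc n)) (H : Euc n → Euc n → ℝ)
    (v : Euc n → ℝ) : Prop :=
  ∀ x ∈ closure Ω, ∀ φ : Euc n → ℝ, ContDiff ℝ 1 φ →
    IsLocalMinOn (fun y => v y - φ y) (closure Ω) x → 0 ≤ v x + H x (gradient φ x)

/-- `v` is a state-constraint viscosity solution on `Ω`. -/
def IsStateConstraintSolution {n : ℕ} (Ω : Set (Euc n)) (H : Euc n → Euc n → ℝ)
    (v : Euc n → ℝ) : Prop :=
  ContinuousOn v (closure Ω) ∧ IsViscositySubsolutionIn Ω H v ∧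
    IsViscositySupersolutionOn Ω H v


/-- the exponential profile is differentiable along a functional -/
lemma hasGradient_exp_inner {n : ℕ} (α β k : ℝ) (hα : 0 < α) (e x : Euc n) :
    HasGradientAt (fun y : Euc n => α * β * Real.exp ((⟪e, y⟫ - k) / α))
      ((β * Real.exp ((⟪e, x⟫ - k) / α)) • e) x := by
  rw [hasGradientAt_iff_hasFDerivAt]
  have h1 : HasFDerivAt (fun y : Euc n => ⟪e, y⟫) (innerSL ℝ e) x := (innerSL ℝ e).hasFDerivAt
  have h2 := (((h1.sub_const k).mul_const (α⁻¹)).exp).const_mul (α * β)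
  simp only [← div_eq_mul_inv] at h2
  refine h2.congr_fderiv ?_
  ext y
  simp [inner_smul_left]
  field_simp

lemma contDiff_exp_inner {n : ℕ} (α β k : ℝ) (e : Euc n) :
    ContDiff ℝ 1 (fun y : Euc n => α * β * Real.exp ((⟪e, y⟫ - k) / α)) := by
  have h : ContDiff ℝ 1 (fun y : Euc n => ⟪e, y⟫) := (innerSL ℝ e).contDiff
  exact contDiff_const.mul (((h.sub contDiff_const).div_const _).exp)

lemma hasGradient_psi {n : ℕ} (α β k ε : ℝ) (hα : 0 < α) (hε : 0 < ε) (x : Euc n) :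
    HasGradientAt (fun y : Euc n => α * β * Real.exp ((√(‖y‖ ^ 2 + ε ^ 2) - k) / α))
      ((β * Real.exp ((√(‖x‖ ^ 2 + ε ^ 2) - k) / α) / √(‖x‖ ^ 2 + ε ^ 2)) • x) x := by
  rw [hasGradientAt_iff_hasFDerivAt]
  have hpos : 0 < ‖x‖ ^ 2 + ε ^ 2 := by positivity
  have hs : 0 < √(‖x‖ ^ 2 + ε ^ 2) := Real.sqrt_pos.2 hpos
  have h0 : HasFDerivAt (fun y : Euc n => ‖y‖ ^ 2 + ε ^ 2) (2 • (innerSL ℝ x)) x :=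
    ((hasStrictFDerivAt_norm_sq x).hasFDerivAt).add_const _
  have h1 := h0.sqrt hpos.ne'
  have h2 := (((h1.sub_const k).mul_const (α⁻¹)).exp).const_mul (α * β)
  simp only [← div_eq_mul_inv] at h2
  refine h2.congr_fderiv ?_
  ext y
  simp [inner_smul_left]
  field_simp

lemma contDiff_psi {n : ℕ} (α β k ε : ℝ) (hε : 0 < ε) :
    ContDiff ℝ 1 (fun y : Euc n => α * β * Real.exp ((√(‖y‖ ^ 2 + ε ^ 2) - k) / α)) := by
  have h : ContDiff ℝ 1 (fun y : Euc n => √(‖y‖ ^ 2 + ε ^ 2)) :=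
    ((contDiff_norm_sq ℝ).add contDiff_const).sqrt (fun x => by positivity)
  exact contDiff_const.mul (((h.sub contDiff_const).div_const _).exp)

lemma exists_unit {n : ℕ} (hn : 1 ≤ n) (x : Euc n) : ∃ e : Euc n, ‖e‖ = 1 ∧ ⟪e, x⟫ = ‖x‖ := by
  by_cases hx : x = 0
  · refine ⟨EuclideanSpace.single ⟨0, hn⟩ 1, by simp, by simp [hx]⟩
  · have : ‖x‖ ≠ 0 := norm_ne_zero_iff.2 hx
    refine ⟨(‖x‖⁻¹) • x, by simp [norm_smul, this], ?_⟩
    rw [real_inner_smul_left, real_inner_self_eq_norm_sq]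
    field_simp

lemma H_exp {n : ℕ} {α β k : ℝ} (hα : 0 < α) (hβ : 0 < β) {H : Euc n → ℝ}
    (hHsmall : ∀ p : Euc n, ‖p‖ ≤ β → H p = -α * ‖p‖) {e x : Euc n} (he : ‖e‖ = 1)
    (hx : ‖x‖ ≤ k) :
    H ((β * Real.exp ((⟪e, x⟫ - k) / α)) • e) = - (α * β * Real.exp ((⟪e, x⟫ - k) / α)) := by
  have h1 : ‖(β * Real.exp ((⟪e, x⟫ - k) / α)) • e‖ = β * Real.exp ((⟪e, x⟫ - k) / α) := by
    rw [norm_smul, he, mul_one, Real.norm_of_nonneg (by positivity)]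
  have h2 : ⟪e, x⟫ ≤ k := by
    have := real_inner_le_norm e x
    rw [he, one_mul] at this
    exact this.trans hx
  have h3 : Real.exp ((⟪e, x⟫ - k) / α) ≤ 1 := by
    rw [Real.exp_le_one_iff]
    exact div_nonpos_of_nonpos_of_nonneg (by linarith) hα.le
  rw [hHsmall _ (by rw [h1]; nlinarith), h1]
  ring

lemma exp_inner_le {n : ℕ} {α β k : ℝ} (hα : 0 < α) (hβ : 0 < β) {e : Euc n} (he : ‖e‖ = 1)
    (y : Euc n) :
    α * β * Real.exp ((⟪e, y⟫ - k) / α) ≤ α * β * Real.exp ((‖y‖ - k) / α) := by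
  have := real_inner_le_norm e y
  rw [he, one_mul] at this
  gcongr

/-- The explicit function is a subsolution. -/
lemma explicit_sub {n : ℕ} (hn : 1 ≤ n) {α β k : ℝ} (hα : 0 < α) (hβ : 0 < β) {H : Euc n → ℝ}
    (hHsmall : ∀ p : Euc n, ‖p‖ ≤ β → H p = -α * ‖p‖) :
    IsViscositySubsolutionIn (ball (0 : Euc n) k) (fun _ p => H p)
        (fun x => α * β * Real.exp ((‖x‖ - k) / α)) := by
  intro x hx φ hφ hmax
  obtain ⟨e, he, hex⟩ := exists_unit hn x
  have hm : IsLocalMax (fun y => α * β * Real.exp ((‖y‖ - k) / α) - φ y) x :=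
    hmax.isLocalMax (isOpen_ball.mem_nhds hx)
  have hm2 : IsLocalMax (fun y => α * β * Real.exp ((⟪e, y⟫ - k) / α) - φ y) x := by
    filter_upwards [hm] with y hy
    have := exp_inner_le (k := k) hα hβ he y
    rw [hex]
    linarith
  have hg := hasGradient_exp_inner α β k hα e x
  have hd : HasGradientAt φ (gradient φ x) x :=
    ((hφ.differentiable one_ne_zero) x).hasGradientAt
  have h0 := hm2.hasFDerivAt_eq_zero (hg.hasFDerivAt.sub hd.hasFDerivAt)
  rw [sub_eq_zero] at h0
  have h1 := (InnerProductSpace.toDual ℝ (Euc n)).injective h0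
  have hx' : ‖x‖ ≤ k := (mem_ball_zero_iff.1 hx).le
  have := H_exp hα hβ hHsmall he hx'
  simp only
  rw [← h1, this, hex]
  simp

lemma H_lower {n : ℕ} {α β : ℝ} (hα : 0 < α) {H : Euc n → ℝ}
    (hHsmall : ∀ p : Euc n, ‖p‖ ≤ β → H p = -α * ‖p‖)
    (hHbig : ∀ p : Euc n, β ≤ ‖p‖ → -α * β ≤ H p) (p : Euc n) :
    -α * β ≤ H p ∧ -α * ‖p‖ ≤ H p := by
  rcases le_total ‖p‖ β with h | h
  · rw [hHsmall p h]
    exact ⟨by nlinarith, le_rfl⟩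
  · have := hHbig p h
    exact ⟨this, by nlinarith⟩

/-- The explicit function is a supersolution. -/
lemma explicit_super {n : ℕ} {α β k : ℝ} (hα : 0 < α) (hβ : 0 < β) (hk : 0 < k) {H : Euc n → ℝ}
    (hHsmall : ∀ p : Euc n, ‖p‖ ≤ β → H p = -α * ‖p‖)
    (hHbig : ∀ p : Euc n, β ≤ ‖p‖ → -α * β ≤ H p) :
    IsViscositySupersolutionOn (ball (0 : Euc n) k) (fun _ p => H p)
        (fun x => α * β * Real.exp ((‖x‖ - k) / α)) := by
  intro x hx φ hφ hmin
  rw [closure_ball _ hk.ne'] at hx hmin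
  obtain ⟨hl1, hl2⟩ := H_lower hα hHsmall hHbig (gradient φ x)
  rw [mem_closedBall_zero_iff] at hx
  rcases hx.eq_or_lt with h | h
  · simp only [h, sub_self, zero_div, Real.exp_zero]
    linarith
  have hm : IsLocalMin (fun y => α * β * Real.exp ((‖y‖ - k) / α) - φ y) x :=
    hmin.isLocalMin (mem_of_superset (isOpen_ball.mem_nhds (mem_ball_zero_iff.2 h))
      ball_subset_closedBall)
  set p := gradient φ x with hp
  have hd : HasGradientAt φ p x := ((hφ.differentiable one_ne_zero) x).hasGradientAt
  have hline : HasDerivAt (fun t : ℝ => x + t • p) p 0 := by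
    simpa using ((hasDerivAt_id (0 : ℝ)).smul_const p).const_add x
  have hφd : HasDerivAt (fun t : ℝ => φ (x + t • p)) (‖p‖ ^ 2) 0 := by
    have h1 : HasFDerivAt φ (InnerProductSpace.toDual ℝ (Euc n) p) (x + (0 : ℝ) • p) := by
      simpa using hd.hasFDerivAt
    have := h1.comp_hasDerivAt (0 : ℝ) hline
    simpa [Function.comp_def] using this
  have hG : HasDerivAt (fun t : ℝ => α * β * Real.exp ((‖x‖ + t * ‖p‖ - k) / α))
      (β * Real.exp ((‖x‖ - k) / α) * ‖p‖) 0 := by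
    have := (((((hasDerivAt_id (0 : ℝ)).mul_const ‖p‖).const_add ‖x‖).sub_const k).div_const
      α).exp.const_mul (α * β)
    refine this.congr_deriv ?_
    simp
    field_simp
  have hlm : IsLocalMinOn (fun t : ℝ => α * β * Real.exp ((‖x‖ + t * ‖p‖ - k) / α)
      - φ (x + t • p)) (Ici 0) 0 := by
    have ht : Tendsto (fun t : ℝ => x + t • p) (𝓝[≥] 0) (𝓝 x) := by
      have := hline.continuousAt.tendsto
      simp only [zero_smul, add_zero] at this
      exact this.mono_left nhdsWithin_le_nhds
    filter_upwards [ht.eventually hm, self_mem_nhdsWithin] with t h1 h2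
    have h3 : ‖x + t • p‖ ≤ ‖x‖ + t * ‖p‖ := by
      refine (norm_add_le _ _).trans ?_
      rw [norm_smul, Real.norm_of_nonneg h2]
    have h4 : α * β * Real.exp ((‖x + t • p‖ - k) / α)
      ≤ α * β * Real.exp ((‖x‖ + t * ‖p‖ - k) / α) := by gcongr
    simp only [zero_mul, add_zero, zero_smul]
    linarith
  have hnn : 0 ≤ β * Real.exp ((‖x‖ - k) / α) * ‖p‖ - ‖p‖ ^ 2 := by
    have h1 := hlm.hasFDerivWithinAt_nonneg (hG.sub hφd).hasFDerivAt.hasFDerivWithinAt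
      (y := 1) (mem_posTangentConeAt_of_segment_subset (by
        rw [zero_add, segment_eq_Icc zero_le_one]
        exact Icc_subset_Ici_self))
    simpa using h1
  have hE := Real.exp_pos ((‖x‖ - k) / α)
  have hle : ‖p‖ ≤ β * Real.exp ((‖x‖ - k) / α) := by
    by_contra hc
    push Not at hc
    have : 0 < ‖p‖ := lt_trans (by positivity) hc
    nlinarith
  have : α * ‖p‖ ≤ α * (β * Real.exp ((‖x‖ - k) / α)) := by gcongr
  simp only
  linarith

lemma super_ge {n : ℕ} (hn : 1 ≤ n) {α β k : ℝ} (hα : 0 < α) (hβ : 0 < β) (hk : 0 < k)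
    {H : Euc n → ℝ}
    (hHsmall : ∀ p : Euc n, ‖p‖ ≤ β → H p = -α * ‖p‖) {v : Euc n → ℝ}
    (hc : ContinuousOn v (closedBall 0 k))
    (hv : IsViscositySupersolutionOn (ball (0 : Euc n) k) (fun _ p => H p) v)
    {x : Euc n} (hx : x ∈ closedBall (0 : Euc n) k) :
    α * β * Real.exp ((‖x‖ - k) / α) ≤ v x := by
  obtain ⟨e, he, hex⟩ := exists_unit hn x
  have hcd := contDiff_exp_inner α β k e
  obtain ⟨z, hz, hmin⟩ := (isCompact_closedBall (0 : Euc n) k).exists_isMinOn ⟨x, hx⟩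
    (hc.sub hcd.continuous.continuousOn)
  have h1 := hv z (by rwa [closure_ball _ hk.ne']) _ hcd
    (by rw [closure_ball _ hk.ne']; exact hmin.localize)
  beta_reduce at h1
  rw [(hasGradient_exp_inner α β k hα e z).gradient,
    H_exp hα hβ hHsmall he (mem_closedBall_zero_iff.1 hz)] at h1
  have h2 := hmin hx
  simp only [mem_ofPred_eq, Pi.sub_apply] at h2
  rw [← hex]
  linarith

lemma sub_le_const {n : ℕ} {k c : ℝ} (hk : 0 < k) {H : Euc n → ℝ}
    (hH : ∀ p, -c ≤ H p) {v : Euc n → ℝ}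
    (hc : ContinuousOn v (closedBall 0 k))
    (hv : IsViscositySubsolutionIn (ball (0 : Euc n) k) (fun _ p => H p) v)
    {x : Euc n} (hx : x ∈ closedBall (0 : Euc n) k) : v x ≤ c := by
  have hint : ∀ x ∈ ball (0 : Euc n) k, v x ≤ c := by
    intro x hx
    obtain ⟨m, hm, hM⟩ := (isCompact_closedBall (0 : Euc n) k).exists_isMaxOn
      ⟨x, ball_subset_closedBall hx⟩ hc
    have hr : 0 < k - ‖x‖ := sub_pos.2 (mem_ball_zero_iff.1 hx)
    have hMx : v x ≤ v m := hM (ball_subset_closedBall hx)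
    set C := (v m - v x + 1) / (k - ‖x‖) ^ 2 with hC
    have hCpos : 0 < C := div_pos (by linarith) (by positivity)
    have hcd : ContDiff ℝ 1 (fun y : Euc n => C * ‖y - x‖ ^ 2) :=
      contDiff_const.mul ((contDiff_id.sub contDiff_const).norm_sq ℝ)
    obtain ⟨z, hz, hmax⟩ := (isCompact_closedBall (0 : Euc n) k).exists_isMaxOn
      ⟨x, ball_subset_closedBall hx⟩ (hc.sub hcd.continuous.continuousOn)
    have h2 := hmax (ball_subset_closedBall hx)
    rw [mem_ofPred_eq] at h2
    have h3 : 0 ≤ C * ‖z - x‖ ^ 2 := by positivity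
    have hzb : z ∈ ball (0 : Euc n) k := by
      rw [mem_ball_zero_iff]
      by_contra hcon
      push Not at hcon
      have h4 : k - ‖x‖ ≤ ‖z - x‖ := by
        have := norm_sub_norm_le z x
        linarith
      have h5 : C * (k - ‖x‖) ^ 2 ≤ C * ‖z - x‖ ^ 2 := by gcongr
      have h6 : C * (k - ‖x‖) ^ 2 = v m - v x + 1 := by
        rw [hC]; field_simp
      have h7 : v z ≤ v m := hM hz
      norm_num at h2
      linarith
    have h1 := hv z hzb _ hcd ((hmax.on_subset ball_subset_closedBall).localize)
    have := hH (gradient (fun y : Euc n => C * ‖y - x‖ ^ 2) z)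
    norm_num at h2
    simp only at h1
    linarith
  have hcl : x ∈ closure (ball (0 : Euc n) k) := by rwa [closure_ball _ hk.ne']
  rw [← closure_ball _ hk.ne'] at hc
  exact le_on_closure hint hc continuousOn_const hcl

lemma sub_le {n : ℕ} {α β k : ℝ} (hα : 0 < α) (hβ : 0 < β) (hk : 0 < k)
    {H : Euc n → ℝ}
    (hHsmall : ∀ p : Euc n, ‖p‖ ≤ β → H p = -α * ‖p‖)
    (hHbig : ∀ p : Euc n, β ≤ ‖p‖ → -α * β ≤ H p) {v : Euc n → ℝ}
    (hc : ContinuousOn v (closedBall 0 k))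
    (hv : IsViscositySubsolutionIn (ball (0 : Euc n) k) (fun _ p => H p) v)
    {x : Euc n} (hx : x ∈ closedBall (0 : Euc n) k) :
    v x ≤ α * β * Real.exp ((‖x‖ - k) / α) := by
  have key : ∀ ε : ℝ, 0 < ε → v x ≤ α * β * Real.exp ((√(‖x‖ ^ 2 + ε ^ 2) - k) / α) := by
    intro ε hε
    have hcd := contDiff_psi (n := n) α β k ε hε
    obtain ⟨z, hz, hmax⟩ := (isCompact_closedBall (0 : Euc n) k).exists_isMaxOn ⟨x, hx⟩
      (hc.sub hcd.continuous.continuousOn)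
    have h2 := hmax hx
    simp only [mem_ofPred_eq, Pi.sub_apply] at h2
    have hzs : ‖z‖ ≤ √(‖z‖ ^ 2 + ε ^ 2) := Real.le_sqrt_of_sq_le (by nlinarith)
    suffices hs : v z ≤ α * β * Real.exp ((√(‖z‖ ^ 2 + ε ^ 2) - k) / α) by linarith
    rcases (mem_closedBall_zero_iff.1 hz).eq_or_lt with h | h
    · have h3 : v z ≤ α * β := sub_le_const hk
        (fun p => by have := (H_lower hα hHsmall hHbig p).1; linarith) hc hv hz
      have h4 : 1 ≤ Real.exp ((√(‖z‖ ^ 2 + ε ^ 2) - k) / α) :=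
        Real.one_le_exp (div_nonneg (by linarith) hα.le)
      have : 0 < α * β := by positivity
      nlinarith
    · have h1 := hv z (mem_ball_zero_iff.2 h) _ hcd
        ((hmax.on_subset ball_subset_closedBall).localize)
      simp only at h1
      rw [(hasGradient_psi α β k ε hα hε z).gradient] at h1
      have h3 := (H_lower hα hHsmall hHbig ((β * Real.exp ((√(‖z‖ ^ 2 + ε ^ 2) - k) / α)
        / √(‖z‖ ^ 2 + ε ^ 2)) • z)).2
      have hs : 0 < √(‖z‖ ^ 2 + ε ^ 2) := Real.sqrt_pos.2 (by positivity)
      have h4 : ‖(β * Real.exp ((√(‖z‖ ^ 2 + ε ^ 2) - k) / α) / √(‖z‖ ^ 2 + ε ^ 2)) • z‖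
          ≤ β * Real.exp ((√(‖z‖ ^ 2 + ε ^ 2) - k) / α) := by
        rw [norm_smul, Real.norm_of_nonneg (by positivity), div_mul_eq_mul_div, div_le_iff₀ hs]
        gcongr
      have h5 := mul_le_mul_of_nonneg_left h4 hα.le
      linarith
  have hcont : Continuous (fun ε : ℝ => α * β * Real.exp ((√(‖x‖ ^ 2 + ε ^ 2) - k) / α)) := by
    fun_prop
  have ht : Tendsto (fun ε : ℝ => α * β * Real.exp ((√(‖x‖ ^ 2 + ε ^ 2) - k) / α)) (𝓝[>] 0)
      (𝓝 (α * β * Real.exp ((‖x‖ - k) / α))) := by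
    have := (hcont.tendsto 0).mono_left (nhdsWithin_le_nhds (s := Ioi 0))
    simpa [Real.sqrt_sq] using this
  refine ge_of_tendsto ht ?_
  filter_upwards [self_mem_nhdsWithin] with ε hε using key ε hε

/-- Proposition 4.1: for `H(p) = -α|p|` for `|p| ≤ β` (extended by a coercive `f ≥ -αβ`),
the function `u_k(x) = αβ e^{(|x|-k)/α}` is the unique state-constraint solution on `B(0,k)`. -/
theorem linear_hamiltonian_explicit_solution {n : ℕ} (hn : 1 ≤ n)
    (α β : ℝ) (hα : 0 < α) (hβ : 0 < β)
    (H : Euc n → ℝ) (hHcont : Continuous H)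
    (hHcoer : ∀ M : ℝ, ∃ R : ℝ, ∀ p : Euc n, R ≤ ‖p‖ → M ≤ H p)
    (hHsmall : ∀ p : Euc n, ‖p‖ ≤ β → H p = -α * ‖p‖)
    (hHbig : ∀ p : Euc n, β ≤ ‖p‖ → -α * β ≤ H p) :
    ∀ k : ℝ, 0 < k →
      IsStateConstraintSolution (ball (0 : Euc n) k) (fun _ p => H p)
        (fun x => α * β * Real.exp ((‖x‖ - k) / α)) ∧
      ∀ v : Euc n → ℝ,
        IsStateConstraintSolution (ball (0 : Euc n) k) (fun _ p => H p) v →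
        EqOn v (fun x => α * β * Real.exp ((‖x‖ - k) / α)) (closure (ball (0 : Euc n) k)) := by
  intro k hk
  refine ⟨⟨by fun_prop, explicit_sub hn hα hβ hHsmall, explicit_super hα hβ hk hHsmall hHbig⟩, ?_⟩
  rintro v ⟨hc, hsub, hsup⟩ x hx
  rw [closure_ball _ hk.ne'] at hc hx
  exact le_antisymm (sub_le hα hβ hk hHsmall hHbig hc hsub hx)
    (super_ge hn hα hβ hk hHsmall hc hsup hx)
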